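/- Let B, g₁, …, g_m, a₁, …, a_p, b₁, …, b_q ∈ ℝ[x₁, …, xₙ] be real multivariate polynomials, let f = (f₁, …, fₙ) be an n-tuple of polynomials, and let γ < λ be real constants. Suppose there exist sum-of-squares polynomials lᵢ¹ (i ≤ p), lᵢ² (i ≤ q), lᵢ³ (i ≤ m) such that each of the following is a sum of squares: (7′) −B − ∑_i lᵢ¹·aᵢ + γ; (8′) B − ∑_i lᵢ²·bᵢ − λ; (11′) −B∘f + B − ∑_i lᵢ³·gᵢ. Assume moreover that f maps the set X = {x : gᵢ(x) ≥ 0 ∀i} into itself, and set X_I = {x ∈ X : aᵢ(x) ≥ 0 ∀i} and X_U = {x ∈ X : bᵢ(x) ≥ 0 ∀i}. Then for every x₀ ∈ X_I, the trajectory defined by x(0) = x₀, x(k+1) = f(x(k)) satisfies x(k) ∉ X_U for all k ∈ ℕ. -/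

import Mathlib

/-- A real multivariate polynomial is a sum of squares if it is a finite sum of squares
of polynomials. -/
def IsSOS {n : ℕ} (q : MvPolynomial (Fin n) ℝ) : Prop :=
  ∃ (z : ℕ) (p : Fin z → MvPolynomial (Fin n) ℝ), q = ∑ j, (p j) ^ 2

/-- A sum of squares is nonnegative at every point. -/
theorem IsSOS.eval_nonneg {n : ℕ} {q : MvPolynomial (Fin n) ℝ} (hq : IsSOS q)
    (x : Fin n → ℝ) : 0 ≤ MvPolynomial.eval x q := by
  obtain ⟨z, p, rfl⟩ := hq
  simp only [map_sum, map_pow]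
  exact Finset.sum_nonneg fun j _ => sq_nonneg _

/-- An SOS-weighted combination of polynomials that are nonnegative at `x` is nonnegative
at `x`. -/
theorem eval_sum_mul_nonneg {n m : ℕ} {l c : Fin m → MvPolynomial (Fin n) ℝ}
    (hl : ∀ i, IsSOS (l i)) {x : Fin n → ℝ} (hc : ∀ i, 0 ≤ MvPolynomial.eval x (c i)) :
    0 ≤ MvPolynomial.eval x (∑ i, l i * c i) := by
  simp only [map_sum, map_mul]
  exact Finset.sum_nonneg fun i _ => mul_nonneg ((hl i).eval_nonneg x) (hc i)

/-- Evaluating a substituted polynomial is evaluating at the image point. -/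
theorem eval_bind₁_apply {n : ℕ} (f : Fin n → MvPolynomial (Fin n) ℝ)
    (B : MvPolynomial (Fin n) ℝ) (x : Fin n → ℝ) :
    MvPolynomial.eval x (MvPolynomial.bind₁ f B) =
      MvPolynomial.eval (fun j => MvPolynomial.eval x (f j)) B :=
  MvPolynomial.eval₂Hom_bind₁ (RingHom.id ℝ) x f B

/-- **SOS barrier certificates certify infinite-horizon safety of dt-DS.**
If the three SOS programs (7′), (8′), (11′) are feasible for the polynomial transition map
`f` on the semi-algebraic sets `X = {g ≥ 0}`, `X_I = X ∩ {a ≥ 0}`, `X_U = X ∩ {b ≥ 0}`,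
and `f` maps `X` into itself, then every trajectory `x (k+1) = f (x k)` starting in `X_I`
never reaches `X_U`. -/
theorem sos_dtDS_safety
    {n m p q : ℕ} (B : MvPolynomial (Fin n) ℝ)
    (g : Fin m → MvPolynomial (Fin n) ℝ)
    (a : Fin p → MvPolynomial (Fin n) ℝ)
    (b : Fin q → MvPolynomial (Fin n) ℝ)
    (f : Fin n → MvPolynomial (Fin n) ℝ)
    (γ lam : ℝ) (hglam : γ < lam)
    (l₁ : Fin p → MvPolynomial (Fin n) ℝ) (hl₁ : ∀ i, IsSOS (l₁ i))
    (l₂ : Fin q → MvPolynomial (Fin n) ℝ) (hl₂ : ∀ i, IsSOS (l₂ i))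
    (l₃ : Fin m → MvPolynomial (Fin n) ℝ) (hl₃ : ∀ i, IsSOS (l₃ i))
    (hsos₁ : IsSOS (-B - (∑ i, l₁ i * a i) + MvPolynomial.C γ))
    (hsos₂ : IsSOS (B - (∑ i, l₂ i * b i) - MvPolynomial.C lam))
    (hsos₃ : IsSOS (-(MvPolynomial.bind₁ f B) + B - ∑ i, l₃ i * g i))
    (X XI XU : Set (Fin n → ℝ))
    (hXdef : X = {x | ∀ i, 0 ≤ MvPolynomial.eval x (g i)})
    (hXIdef : XI = {x ∈ X | ∀ i, 0 ≤ MvPolynomial.eval x (a i)})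
    (hXUdef : XU = {x ∈ X | ∀ i, 0 ≤ MvPolynomial.eval x (b i)})
    (hfX : ∀ x ∈ X, (fun j => MvPolynomial.eval x (f j)) ∈ X)
    (x₀ : Fin n → ℝ) (hx₀ : x₀ ∈ XI) :
    ∀ k : ℕ, (fun x : Fin n → ℝ => fun j => MvPolynomial.eval x (f j))^[k] x₀ ∉ XU := by
  subst hXdef hXIdef hXUdef
  intro k
  have invariant : ∀ k : ℕ,
      (∀ i, 0 ≤ MvPolynomial.eval
        ((fun x : Fin n → ℝ => fun j => MvPolynomial.eval x (f j))^[k] x₀) (g i)) ∧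
      MvPolynomial.eval
        ((fun x : Fin n → ℝ => fun j => MvPolynomial.eval x (f j))^[k] x₀) B ≤ γ := by
    intro k
    induction k with
    | zero =>
      refine ⟨hx₀.1, ?_⟩
      have h := hsos₁.eval_nonneg x₀
      have hs := eval_sum_mul_nonneg hl₁ hx₀.2
      simp only [map_add, map_sub, map_neg, MvPolynomial.eval_C] at h
      simp only [Function.iterate_zero, id_eq]
      linarith
    | succ k ih =>
      rw [Function.iterate_succ_apply']
      obtain ⟨hX, hB⟩ := ih
      refine ⟨hfX _ hX, ?_⟩
      have h := hsos₃.eval_nonneg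
        ((fun x : Fin n → ℝ => fun j => MvPolynomial.eval x (f j))^[k] x₀)
      have hs := eval_sum_mul_nonneg hl₃ hX
      simp only [map_add, map_sub, map_neg, eval_bind₁_apply] at h
      linarith
  rintro ⟨-, hU⟩
  have h := hsos₂.eval_nonneg
    ((fun x : Fin n → ℝ => fun j => MvPolynomial.eval x (f j))^[k] x₀)
  have hs := eval_sum_mul_nonneg hl₂ hU
  simp only [map_sub, MvPolynomial.eval_C] at h
  linarith [(invariant k).2]
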